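/- arXiv:1803.01143 — 2 statements merged into one kernel-verified Lean document; each statement's English description precedes it below -/
import Mathlib

section
/- Let H be a real or complex Hilbert space, T a densely defined selfadjoint operator on H with finite-dimensional kernel and closed range, and M : H → H a bounded invertible linear operator with bounded inverse. Let S be the operator with domain D(S) = {x ∈ H : M x ∈ D(T)} defined by S x = M*(T(M x)), where M* is the adjoint of M. Then D(S) is dense in H and S is a selfadjoint operator with finite-dimensional kernel and closed range; in particular S is a selfadjoint Fredholm operator of index 0, i.e. dim ker S = dim (ran S)ᗮ. -/
/-- The operator `S` with domain `{x : H | M x ∈ D(T)}` given by `S x = M* (T (M x))`. -/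
noncomputable def conjugatedOperator {𝕜 H : Type*} [RCLike 𝕜] [NormedAddCommGroup H]
    [InnerProductSpace 𝕜 H] [CompleteSpace H] (T : H →ₗ.[𝕜] H) (M : H ≃L[𝕜] H) :
    H →ₗ.[𝕜] H where
  domain := T.domain.comap ((M : H →L[𝕜] H) : H →ₗ[𝕜] H)
  toFun := (ContinuousLinearMap.adjoint (M : H →L[𝕜] H) : H →ₗ[𝕜] H).comp
    (T.toFun.comp (((M : H →L[𝕜] H) : H →ₗ[𝕜] H).restrict fun _ hx => hx))

section Helpers

variable {𝕜 H : Type*} [RCLike 𝕜] [NormedAddCommGroup H] [InnerProductSpace 𝕜 H]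
  [CompleteSpace H]

lemma conj_apply (T : H →ₗ.[𝕜] H) (M : H ≃L[𝕜] H) (x : (conjugatedOperator T M).domain) :
    (conjugatedOperator T M) x =
      ContinuousLinearMap.adjoint (M : H →L[𝕜] H) (T ⟨M x, x.2⟩) := rfl

lemma conj_adj_left (M : H ≃L[𝕜] H) (y : H) :
    ContinuousLinearMap.adjoint (M : H →L[𝕜] H)
      (ContinuousLinearMap.adjoint (M.symm : H →L[𝕜] H) y) = y := by
  refine ext_inner_right 𝕜 fun v => ?_
  simp [ContinuousLinearMap.adjoint_inner_left]

lemma conj_adj_right (M : H ≃L[𝕜] H) (y : H) :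
    ContinuousLinearMap.adjoint (M.symm : H →L[𝕜] H)
      (ContinuousLinearMap.adjoint (M : H →L[𝕜] H) y) = y := by
  refine ext_inner_right 𝕜 fun v => ?_
  simp [ContinuousLinearMap.adjoint_inner_left]

lemma conj_dense (T : H →ₗ.[𝕜] H) (hdense : Dense (T.domain : Set H)) (M : H ≃L[𝕜] H) :
    Dense ((conjugatedOperator T M).domain : Set H) :=
  hdense.preimage M.toHomeomorph.isOpenMap

lemma sa_symm (T : H →ₗ.[𝕜] H) (hdense : Dense (T.domain : Set H)) (hsa : T.adjoint = T) :
    T.IsFormalAdjoint T := by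
  have h := LinearPMap.adjoint_isFormalAdjoint hdense
  rwa [hsa] at h

lemma conj_sa (T : H →ₗ.[𝕜] H) (hdense : Dense (T.domain : Set H)) (hsa : T.adjoint = T)
    (M : H ≃L[𝕜] H) : (conjugatedOperator T M).adjoint = conjugatedOperator T M := by
  have hS := conj_dense T hdense M
  have hT := sa_symm T hdense hsa
  have hle : conjugatedOperator T M ≤ (conjugatedOperator T M).adjoint := by
    apply LinearPMap.IsFormalAdjoint.le_adjoint hS
    intro x y
    rw [conj_apply, conj_apply, ContinuousLinearMap.adjoint_inner_left,
      ContinuousLinearMap.adjoint_inner_right]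
    exact hT ⟨M x, x.2⟩ ⟨M y, y.2⟩
  refine (LinearPMap.eq_of_le_of_domain_eq hle (le_antisymm hle.1 ?_)).symm
  intro y hy
  change M y ∈ T.domain
  rw [← hsa]
  refine LinearPMap.mem_adjoint_domain_of_exists _
    ⟨ContinuousLinearMap.adjoint (M.symm : H →L[𝕜] H)
      ((conjugatedOperator T M).adjoint ⟨y, hy⟩), fun u => ?_⟩
  have hu : M (M.symm u) ∈ T.domain := by simp
  have h := LinearPMap.adjoint_isFormalAdjoint hS ⟨y, hy⟩ ⟨M.symm u, hu⟩
  rw [conj_apply, ContinuousLinearMap.adjoint_inner_right] at h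
  rw [ContinuousLinearMap.adjoint_inner_left]
  simpa using h

lemma sa_range_orthogonal (S : H →ₗ.[𝕜] H) (hdense : Dense (S.domain : Set H))
    (hsa : S.adjoint = S) :
    (LinearMap.range S.toFun)ᗮ = (LinearMap.ker S.toFun).map S.domain.subtype := by
  have hS := sa_symm S hdense hsa
  ext y
  rw [Submodule.mem_orthogonal, Submodule.mem_map]
  constructor
  · intro h
    have h0 : ∀ x : S.domain, inner 𝕜 (0 : H) (x : H) = inner 𝕜 y (S x) := fun x => by
      rw [inner_zero_left, inner_eq_zero_symm.mp (h (S x) ⟨x, rfl⟩)]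
    have hy : y ∈ S.domain := by
      rw [← hsa]
      exact LinearPMap.mem_adjoint_domain_of_exists _ ⟨0, h0⟩
    refine ⟨⟨y, hy⟩, ?_, rfl⟩
    rw [LinearMap.mem_ker]
    change S ⟨y, hy⟩ = 0
    refine hdense.eq_of_inner_left 𝕜 fun v hv => ?_
    rw [h0 ⟨v, hv⟩]
    exact hS ⟨y, hy⟩ ⟨v, hv⟩
  · rintro ⟨x, hx, rfl⟩ _ ⟨u, rfl⟩
    have hx' : S x = 0 := hx
    have := hS u x
    rw [hx', inner_zero_right] at this
    exact this

end Helpers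

/-- If `T` is a densely defined selfadjoint operator with finite-dimensional kernel and
closed range, and `M` is a bounded invertible operator with bounded inverse, then the
operator `S x = M* (T (M x))` with domain `{x : H | M x ∈ D(T)}` is densely defined,
selfadjoint, has finite-dimensional kernel and closed range; in particular it is a
selfadjoint Fredholm operator of index `0`, i.e. `dim ker S = dim (ran S)ᗮ`. -/
theorem conjugatedOperator_selfAdjoint_fredholm
    {𝕜 H : Type*} [RCLike 𝕜] [NormedAddCommGroup H] [InnerProductSpace 𝕜 H]
    [CompleteSpace H] (T : H →ₗ.[𝕜] H)
    (hdense : Dense (T.domain : Set H))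
    (hsa : T.adjoint = T)
    (hker : FiniteDimensional 𝕜 (LinearMap.ker T.toFun))
    (hran : IsClosed ((LinearMap.range T.toFun : Submodule 𝕜 H) : Set H))
    (M : H ≃L[𝕜] H) :
    Dense ((conjugatedOperator T M).domain : Set H) ∧
    (conjugatedOperator T M).adjoint = conjugatedOperator T M ∧
    FiniteDimensional 𝕜 (LinearMap.ker (conjugatedOperator T M).toFun) ∧
    IsClosed ((LinearMap.range (conjugatedOperator T M).toFun : Submodule 𝕜 H) : Set H) ∧
    Module.finrank 𝕜 (LinearMap.ker (conjugatedOperator T M).toFun)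
      = Module.finrank 𝕜 ((LinearMap.range (conjugatedOperator T M).toFun)ᗮ) := by
  have hS := conj_dense T hdense M
  have hSa := conj_sa T hdense hsa M
  refine ⟨hS, hSa, ?_, ?_, ?_⟩
  · let f : LinearMap.ker (conjugatedOperator T M).toFun →ₗ[𝕜] LinearMap.ker T.toFun :=
      ((((M : H →L[𝕜] H) : H →ₗ[𝕜] H).restrict (p := (conjugatedOperator T M).domain)
        (q := T.domain) fun _ hx => hx)).restrict (fun x hx => by
          rw [LinearMap.mem_ker] at hx ⊢
          have h : ContinuousLinearMap.adjoint (M : H →L[𝕜] H) (T ⟨M x, x.2⟩) = 0 := hx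
          have h2 := conj_adj_right M (T ⟨M x, x.2⟩)
          rw [h, map_zero] at h2
          exact h2.symm)
    refine FiniteDimensional.of_injective f ?_
    intro x y hxy
    have h : M (x : (conjugatedOperator T M).domain) = M (y : (conjugatedOperator T M).domain) :=
      congrArg (fun z : LinearMap.ker T.toFun => ((z : T.domain) : H)) hxy
    exact Subtype.ext (Subtype.ext (M.injective h))
  · have : ((LinearMap.range (conjugatedOperator T M).toFun : Submodule 𝕜 H) : Set H) =
        (ContinuousLinearMap.adjoint (M.symm : H →L[𝕜] H)) ⁻¹'
          ((LinearMap.range T.toFun : Submodule 𝕜 H) : Set H) := by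
      ext y
      constructor
      · rintro ⟨x, rfl⟩
        exact ⟨⟨M x, x.2⟩, (conj_adj_right M (T ⟨M x, x.2⟩)).symm⟩
      · rintro ⟨u, hu⟩
        have hm : M (M.symm u) ∈ T.domain := by simp
        refine ⟨⟨M.symm u, hm⟩, ?_⟩
        change ContinuousLinearMap.adjoint (M : H →L[𝕜] H) (T ⟨M (M.symm u), hm⟩) = y
        have he : (⟨M (M.symm u), hm⟩ : T.domain) = u := Subtype.ext (by simp)
        have hu' : T u = _ := hu
        rw [he, hu', conj_adj_left]
    rw [this]
    exact hran.preimage (ContinuousLinearMap.continuous _)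
  · rw [sa_range_orthogonal _ hS hSa]
    exact (Submodule.equivMapOfInjective _ (Submodule.injective_subtype _) _).finrank_eq
end

section
/- Let U, W be closed subspaces of a Hilbert space H whose orthogonal projections P_U, P_W satisfy ‖P_U − P_W‖ < 1. Then the restriction of P_W to U is a bijective bounded linear map from U onto W with bounded inverse, i.e. a continuous linear isomorphism from U onto W. -/
/-- A map onto `V` with residuals orthogonal to `V` fixes `V` pointwise. -/
theorem gap_proj_fix {𝕜 H : Type*} [RCLike 𝕜] [NormedAddCommGroup H] [InnerProductSpace 𝕜 H]
    (V : Submodule 𝕜 H) (P : H →L[𝕜] H)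
    (hP : ∀ x : H, P x ∈ V ∧ x - P x ∈ Vᗮ) (x : H) (hx : x ∈ V) : P x = x := by
  have h1 : x - P x ∈ V := V.sub_mem hx (hP x).1
  have h2 : inner 𝕜 (x - P x) (x - P x) = 0 :=
    (Submodule.mem_orthogonal V _).1 (hP x).2 _ h1
  exact (sub_eq_zero.1 (inner_self_eq_zero.1 h2)).symm

/-- If `U, W` are closed subspaces of a Hilbert space whose orthogonal projections
`P, Q` satisfy `‖P − Q‖ < 1`, then the restriction of the projection onto `W` to `U` is
a continuous linear isomorphism from `U` onto `W`. -/
theorem restriction_of_projection_isomorphism_of_gap_lt_one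
    {𝕜 H : Type*} [RCLike 𝕜] [NormedAddCommGroup H] [InnerProductSpace 𝕜 H]
    [CompleteSpace H] (U W : Submodule 𝕜 H)
    (hUc : IsClosed (U : Set H)) (hWc : IsClosed (W : Set H))
    (P Q : H →L[𝕜] H)
    (hP : ∀ x : H, P x ∈ U ∧ x - P x ∈ Uᗮ)
    (hQ : ∀ x : H, Q x ∈ W ∧ x - Q x ∈ Wᗮ)
    (hgap : ‖P - Q‖ < 1) :
    ∃ f : ↥U ≃L[𝕜] ↥W, ∀ x : U, (f x : H) = Q x := by
  have : CompleteSpace U := hUc.completeSpace_coe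
  have : CompleteSpace W := hWc.completeSpace_coe
  have hPf := gap_proj_fix U P hP
  have hQf := gap_proj_fix W Q hQ
  let g : U →L[𝕜] W := (Q.comp U.subtypeL).codRestrict W (fun x => (hQ _).1)
  have hg : ∀ x : U, (g x : H) = Q x := fun x => rfl
  have hker : g.ker = ⊥ := by
    refine (Submodule.eq_bot_iff _).2 fun x hx => ?_
    have hx0 : g x = 0 := hx
    have hq : Q x = 0 := by rw [← hg, hx0]; rfl
    have h1 : (P - Q) (x : H) = x := by
      simp [hq, hPf x x.2]
    have h2 := (P - Q).le_opNorm (x : H)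
    rw [h1] at h2
    have h3 : ‖(x : H)‖ = 0 := by
      have := norm_nonneg (x : H)
      nlinarith
    exact Subtype.ext (norm_eq_zero.1 h3)
  have hrange : g.range = ⊤ := by
    refine Submodule.eq_top_iff'.2 fun w => ?_
    have hu : IsUnit (1 - (Q - P)) :=
      isUnit_one_sub_of_norm_lt_one (by rwa [norm_sub_rev])
    obtain ⟨u, hu⟩ := hu
    have h1 : (1 - (Q - P)) ((u⁻¹ : (H →L[𝕜] H)ˣ).1 (w : H)) = w := by
      rw [← hu]
      have := congrArg (fun T : H →L[𝕜] H => T (w : H)) u.mul_inv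
      exact this
    set y := (u⁻¹ : (H →L[𝕜] H)ˣ).1 (w : H)
    refine ⟨⟨P y, (hP y).1⟩, Subtype.ext ?_⟩
    change Q (P y) = w
    have h2 := congrArg Q h1
    simpa [hQf w w.2, hQf (Q y) (hQ y).1] using h2
  exact ⟨ContinuousLinearEquiv.ofBijective g hker hrange, fun x => rfl⟩
end
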